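/- Let k be a field, let d be a positive integer, and let w = (w_1, ..., w_d) be a d-tuple of positive integers with gcd(w_1, ..., w_d) = 1. Let f_1, ..., f_d be nonzero polynomials in k[x_1, ..., x_d], and suppose that the quotient of the formal power series ring k[[x_1, ..., x_d]] by the ideal generated by f_1, ..., f_d is a finite-dimensional k-vector space of dimension D. Then D · w_1 · w_2 · ... · w_d ≤ deg_w(f_1) · deg_w(f_2) · ... · deg_w(f_d). -/

import Mathlib

open Finset MvPolynomial


theorem aux_pow_le {R : Type*} [CommRing R] {d : ℕ} (g : Fin d → R) (n : ℕ) :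
    (Ideal.span (Set.range g)) ^ n ≤
      Ideal.span ((fun α : Fin d → ℕ => ∏ i, g i ^ α i) '' (piAntidiag univ n : Finset (Fin d → ℕ))) := by
  induction n with
  | zero =>
    simp
  | succ n ih =>
    rw [pow_succ]
    refine (Ideal.mul_mono_left ih).trans ?_
    rw [Ideal.span_mul_span', Ideal.span_le]
    rintro _ ⟨_, ⟨α, hα, rfl⟩, _, ⟨j, rfl⟩, rfl⟩
    apply Ideal.subset_span
    refine ⟨α + Pi.single j 1, ?_, ?_⟩
    · simp only [mem_coe, mem_piAntidiag] at hα ⊢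
      simp [Finset.sum_add_distrib, hα.1]
    · simp only [Pi.add_apply, pow_add, Finset.prod_mul_distrib]
      congr 1
      rw [Finset.prod_eq_single j] <;> simp +contextual

theorem aux_mem_pow {R : Type*} [CommRing R] {d : ℕ} (g : Fin d → R) (n : ℕ) (z : R)
    (hz : z ∈ (Ideal.span (Set.range g)) ^ n) :
    ∃ c : (Fin d → ℕ) → R, z = ∑ α ∈ piAntidiag univ n, c α * ∏ i, g i ^ α i := by
  have := aux_pow_le g n hz
  obtain ⟨c, hc⟩ := (Submodule.mem_span_image_finset_iff_exists_fun R).1 this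
  refine ⟨fun α => if h : α ∈ piAntidiag univ n then c ⟨α, h⟩ else 0, ?_⟩
  rw [← hc, ← Finset.sum_coe_sort (piAntidiag univ n)]
  refine Finset.sum_congr rfl fun α _ => ?_
  simp only [smul_eq_mul, dif_pos α.2]

theorem aux_mon_mem {R : Type*} [CommRing R] {d : ℕ} (I : Ideal R) (g : Fin d → R)
    (hg : ∀ i, g i ∈ I) (α : Fin d → ℕ) :
    ∏ i, g i ^ α i ∈ I ^ (∑ i, α i) := by
  rw [← Finset.prod_pow_eq_pow_sum]
  exact Ideal.prod_mem_prod fun i _ => Ideal.pow_mem_pow (hg i) _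

theorem aux_mon_sub {R : Type*} [CommRing R] {d : ℕ} (I : Ideal R) (f g : Fin d → R)
    (hf : ∀ i, f i ∈ I) (hg : ∀ i, g i ∈ I) (hfg : ∀ i, f i - g i ∈ I ^ 2) (α : Fin d → ℕ) :
    ∏ i, f i ^ α i - ∏ i, g i ^ α i ∈ I ^ (∑ i, α i + 1) := by
  let P : ℕ → R → R → Prop := fun n p q => p ∈ I ^ n ∧ q ∈ I ^ n ∧ p - q ∈ I ^ (n + 1)
  have hmul : ∀ n m p q p' q', P n p q → P m p' q' → P (n + m) (p * p') (q * q') := by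
    rintro n m p q p' q' ⟨h1, h2, h3⟩ ⟨h1', h2', h3'⟩
    refine ⟨?_, ?_, ?_⟩
    · rw [pow_add]; exact Ideal.mul_mem_mul h1 h1'
    · rw [pow_add]; exact Ideal.mul_mem_mul h2 h2'
    · have : p * p' - q * q' = p * (p' - q') + (p - q) * q' := by ring
      rw [this]
      refine Ideal.add_mem _ ?_ ?_
      · rw [add_assoc, pow_add]; exact Ideal.mul_mem_mul h1 h3'
      · rw [add_right_comm, pow_add]; exact Ideal.mul_mem_mul h3 h2'
  have hone : P 0 1 1 := by simp [P]
  have hpow : ∀ i n, P n (f i ^ n) (g i ^ n) := by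
    intro i n
    induction n with
    | zero => simpa using hone
    | succ n ih =>
      rw [pow_succ, pow_succ]
      exact hmul _ _ _ _ _ _ ih ⟨by simpa using hf i, by simpa using hg i, hfg i⟩
  have : ∀ s : Finset (Fin d), P (∑ i ∈ s, α i) (∏ i ∈ s, f i ^ α i) (∏ i ∈ s, g i ^ α i) := by
    intro s
    induction s using Finset.induction_on with
    | empty => simpa using hone
    | insert a s ha ih =>
      rw [Finset.sum_insert ha, Finset.prod_insert ha, Finset.prod_insert ha]
      exact hmul _ _ _ _ _ _ (hpow _ _) ih
  exact (this univ).2.2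

/-- quasi-regularity -/
def QReg {R : Type*} [CommRing R] {d : ℕ} (g : Fin d → R) : Prop :=
  ∀ (n : ℕ) (c : (Fin d → ℕ) → R),
    ∑ α ∈ piAntidiag univ n, c α * ∏ i, g i ^ α i ∈ (Ideal.span (Set.range g)) ^ (n + 1) →
    ∀ α ∈ piAntidiag (univ : Finset (Fin d)) n, c α ∈ Ideal.span (Set.range g)

/-- linear independence from quasi-regularity -/
theorem QReg.linInd {k R : Type*} [Field k] [CommRing R] [Algebra k R] {d D : ℕ} (f : Fin d → R)
    (hq : QReg f) (b : Fin D → R)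
    (hb : LinearIndependent k fun j => Ideal.Quotient.mk (Ideal.span (Set.range f)) (b j)) :
    LinearIndependent k fun p : (Fin d → ℕ) × Fin D => b p.2 * ∏ i, f i ^ p.1 i := by
  classical
  rw [linearIndependent_iff']
  intro s c hs
  by_contra! hne
  obtain ⟨p0, hp0, hc0⟩ := hne
  -- extend c by zero
  let c' : (Fin d → ℕ) × Fin D → k := fun p => if p ∈ s then c p else 0
  have hex : ∃ n, ∃ p, c' p ≠ 0 ∧ ∑ i, p.1 i = n := ⟨_, p0, by simpa [c', hp0] using hc0, rfl⟩
  let n := Nat.find hex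
  obtain ⟨p1, hp1, hn1⟩ := Nat.find_spec hex
  have hmin : ∀ p, c' p ≠ 0 → n ≤ ∑ i, p.1 i := fun p hp => Nat.find_min' hex ⟨p, hp, rfl⟩
  set J := Ideal.span (Set.range f) with hJ
  have hfJ : ∀ i, f i ∈ J := fun i => Ideal.subset_span ⟨i, rfl⟩
  let e : (Fin d → ℕ) → R := fun α => ∑ j, c' (α, j) • b j
  -- the low part
  let t : Finset ((Fin d → ℕ) × Fin D) := s ∪ (piAntidiag univ n) ×ˢ univ
  have hs' : ∑ p ∈ t, c' p • (b p.2 * ∏ i, f i ^ p.1 i) = 0 := by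
    rw [← Finset.sum_subset (Finset.subset_union_left (s₁ := s))]
    · rw [← hs]; exact Finset.sum_congr rfl fun p hp => by simp [c', hp]
    · intro p _ hp; simp [c', hp]
  rw [← Finset.sum_sdiff (Finset.subset_union_right (s₁ := s))] at hs'
  have h1 : ∑ p ∈ t \ (piAntidiag univ n) ×ˢ univ, c' p • (b p.2 * ∏ i, f i ^ p.1 i) ∈ J ^ (n+1) := by
    refine Ideal.sum_mem _ fun p hp => ?_
    by_cases hc : c' p = 0
    · simp [hc]
    rw [Algebra.smul_def]
    refine Ideal.mul_mem_left _ _ (Ideal.mul_mem_left _ _ ?_)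
    refine Ideal.pow_le_pow_right ?_ (aux_mon_mem J f hfJ p.1)
    have := hmin p hc
    have h2 : ∑ i, p.1 i ≠ n := by
      intro h
      simp [h] at hp
    omega
  have h2 : ∑ α ∈ piAntidiag univ n, e α * ∏ i, f i ^ α i ∈ J ^ (n + 1) := by
    have : ∑ α ∈ piAntidiag univ n, e α * ∏ i, f i ^ α i =
      ∑ p ∈ (piAntidiag univ n) ×ˢ univ, c' p • (b p.2 * ∏ i, f i ^ p.1 i) := by
      rw [Finset.sum_product]
      refine Finset.sum_congr rfl fun α _ => ?_
      simp only [e, Finset.sum_mul, smul_mul_assoc]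
    rw [this, ← neg_eq_of_add_eq_zero_right hs']
    exact neg_mem h1
  have h3 := hq n e h2 p1.1 (mem_piAntidiag.2 ⟨hn1, by simp⟩)
  rw [← Ideal.Quotient.eq_zero_iff_mem] at h3
  have h4 : ∑ j, c' (p1.1, j) • Ideal.Quotient.mk J (b j) = 0 := by
    rw [← h3]
    simp only [e, map_sum]
    rfl
  exact hp1 (linearIndependent_iff'.1 hb univ _ h4 p1.2 (mem_univ _))

theorem QReg.transfer {R : Type*} [CommRing R] {d : ℕ} (f g : Fin d → R) (hg : QReg g)
    (hI : Ideal.span (Set.range f) = Ideal.span (Set.range g))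
    (hfg : ∀ i, f i - g i ∈ (Ideal.span (Set.range f)) ^ 2) : QReg f := by
  intro n c hc
  rw [hI] at hc ⊢
  apply hg n c
  have : ∑ α ∈ piAntidiag univ n, c α * ∏ i, g i ^ α i =
    ∑ α ∈ piAntidiag univ n, c α * ∏ i, f i ^ α i -
    ∑ α ∈ piAntidiag univ n, c α * (∏ i, f i ^ α i - ∏ i, g i ^ α i) := by
    rw [← Finset.sum_sub_distrib]
    exact Finset.sum_congr rfl fun _ _ => by ring
  rw [this]
  refine sub_mem hc (Ideal.sum_mem _ fun α hα => Ideal.mul_mem_left _ _ ?_)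
  have h := aux_mon_sub (Ideal.span (Set.range g)) f g
    (fun i => hI ▸ Ideal.subset_span ⟨i, rfl⟩) (fun i => Ideal.subset_span ⟨i, rfl⟩)
    (fun i => hI ▸ hfg i) α
  simp at hα
  rwa [hα] at h

section polyT

/-- polynomials of degree `< n` -/
noncomputable def FF (k : Type*) [Field k] (d n : ℕ) : Submodule k (MvPolynomial (Fin d) k) :=
  MvPolynomial.restrictSupport k {m | m.degree < n}

theorem mem_FF {k : Type*} [Field k] {d n : ℕ} {p : MvPolynomial (Fin d) k} :
    p ∈ FF k d n ↔ ∀ m, p.coeff m ≠ 0 → m.degree < n := by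
  rw [FF, mem_restrictSupport_iff]
  constructor
  · intro h m hm; exact h (mem_support_iff.2 hm)
  · intro h m hm; exact h m (mem_support_iff.1 hm)

theorem FF_mul {k : Type*} [Field k] {d a b c : ℕ} {p q : MvPolynomial (Fin d) k}
    (hp : p ∈ FF k d a) (hq : q ∈ FF k d b) (hc : a + b ≤ c + 1) : p * q ∈ FF k d c := by
  classical
  rw [mem_FF] at *
  intro m hm
  rw [coeff_mul] at hm
  obtain ⟨⟨x, y⟩, hxy, h⟩ := Finset.exists_ne_zero_of_sum_ne_zero hm
  have h1 := hp x (left_ne_zero_of_mul h)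
  have h2 := hq y (right_ne_zero_of_mul h)
  rw [HasAntidiagonal.mem_antidiagonal] at hxy
  simp only at hxy
  rw [← hxy, map_add]
  omega

theorem FF_mono {k : Type*} [Field k] {d a b : ℕ} (h : a ≤ b) : FF k d a ≤ FF k d b := by
  intro p hp
  rw [mem_FF] at *
  exact fun m hm => (hp m hm).trans_le h

theorem aux_monomial_eq {k : Type*} [Field k] {d : ℕ} (m : Fin d →₀ ℕ) :
    (monomial m (1 : k) : MvPolynomial (Fin d) k) = ∏ i, X i ^ m i := by
  rw [monomial_eq, C_1, one_mul, Finsupp.prod_fintype]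
  simp

variable {k : Type*} [Field k] {d : ℕ} (N : ℕ) (g : Fin d → MvPolynomial (Fin d) k)

/-- the triangular map -/
noncomputable def TT : MvPolynomial (Fin d) k →ₗ[k] MvPolynomial (Fin d) k :=
  (MvPolynomial.basisMonomials (Fin d) k).constr k
    fun m => ∏ i, (X i ^ (m i % N) * g i ^ (m i / N))

theorem TT_monomial (m : Fin d →₀ ℕ) : TT N g (monomial m 1) =
    ∏ i, (X i ^ (m i % N) * g i ^ (m i / N)) := by
  have := (MvPolynomial.basisMonomials (Fin d) k).constr_basis k
    (fun m => ∏ i, (X i ^ (m i % N) * g i ^ (m i / N))) m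
  simpa [TT] using this

theorem TT_shift (hN : 0 < N) (i : Fin d) (p : MvPolynomial (Fin d) k) :
    TT N g (X i ^ N * p) = g i * TT N g p := by
  have : TT N g ∘ₗ LinearMap.mulLeft k (X i ^ N) = LinearMap.mulLeft k (g i) ∘ₗ TT N g := by
    refine (MvPolynomial.basisMonomials (Fin d) k).ext fun m => ?_
    simp only [coe_basisMonomials, LinearMap.comp_apply, LinearMap.mulLeft_apply]
    rw [X_pow_eq_monomial, monomial_mul, one_mul, TT_monomial, TT_monomial]
    rw [← Finset.mul_prod_erase _ _ (mem_univ i), ← Finset.mul_prod_erase _ _ (mem_univ i)]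
    rw [Finset.prod_congr (g := fun j => (X j ^ (m j % N) * g j ^ (m j / N))) rfl]
    · simp [Nat.add_div_left _ hN, pow_succ]; ring
    · intro j hj
      have : j ≠ i := (Finset.mem_erase.1 hj).1
      simp [this.symm]
  exact LinearMap.congr_fun this p

theorem TT_shift' (hN : 0 < N) (α : Fin d → ℕ) (p : MvPolynomial (Fin d) k) :
    TT N g (p * ∏ i, (X i ^ N) ^ α i) = TT N g p * ∏ i, g i ^ α i := by
  have hpow : ∀ i n p, TT N g (p * (X i ^ N) ^ n) = TT N g p * g i ^ n := by
    intro i n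
    induction n with
    | zero => simp
    | succ n ih =>
      intro p
      rw [pow_succ', ← mul_assoc, ih, mul_comm p, TT_shift N g hN]; ring
  have : ∀ (s : Finset (Fin d)) p,
      TT N g (p * ∏ i ∈ s, (X i ^ N) ^ α i) = TT N g p * ∏ i ∈ s, g i ^ α i := by
    intro s
    induction s using Finset.induction_on with
    | empty => simp
    | insert a s ha ih =>
      intro p
      rw [Finset.prod_insert ha, Finset.prod_insert ha, ← mul_assoc, ih, hpow, mul_assoc]
  exact this univ p

theorem TT_sub (hN : 0 < N) (hg : ∀ i, g i - X i ^ N ∈ FF k d N) (n : ℕ)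
    (p : MvPolynomial (Fin d) k) (hp : p ∈ FF k d (n + 1)) : TT N g p - p ∈ FF k d n := by
  let P : ℕ → MvPolynomial (Fin d) k → MvPolynomial (Fin d) k → Prop :=
    fun n p q => p ∈ FF k d (n + 1) ∧ q ∈ FF k d (n + 1) ∧ p - q ∈ FF k d n
  have hmul : ∀ n m p q p' q', P n p q → P m p' q' → P (n + m) (p * p') (q * q') := by
    rintro n m p q p' q' ⟨h1, h2, h3⟩ ⟨h1', h2', h3'⟩
    refine ⟨FF_mul h1 h1' (by omega), FF_mul h2 h2' (by omega), ?_⟩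
    have : p * p' - q * q' = p * (p' - q') + (p - q) * q' := by ring
    rw [this]
    exact add_mem (FF_mul h1 h3' (by omega)) (FF_mul h3 h2' (by omega))
  have hXn : ∀ i n, (X i ^ n : MvPolynomial (Fin d) k) ∈ FF k d (n + 1) := by
    intro i n
    rw [X_pow_eq_monomial, FF, monomial_mem_restrictSupport]
    left
    simp
  have hone : P 0 1 1 := by
    have : (1 : MvPolynomial (Fin d) k) ∈ FF k d 1 := by
      rw [FF, one_def, monomial_mem_restrictSupport]; left; simp
    exact ⟨this, this, by simp⟩
  have hX : ∀ i n, P n (X i ^ n) (X i ^ n) := fun i n => ⟨hXn i n, hXn i n, by simp⟩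
  have hgP : ∀ i, P N (g i) (X i ^ N) := by
    intro i
    refine ⟨?_, hXn i N, hg i⟩
    have : g i = (g i - X i ^ N) + X i ^ N := by ring
    rw [this]
    exact add_mem (FF_mono (by omega) (hg i)) (hXn i N)
  have hpow : ∀ i n, P (N * n) (g i ^ n) (X i ^ (N * n)) := by
    intro i n
    induction n with
    | zero => simpa using hone
    | succ n ih =>
      rw [mul_add, pow_add, pow_add, mul_one, pow_one]
      exact hmul _ _ _ _ _ _ ih (hgP i)
  have hmon : ∀ (m : Fin d →₀ ℕ) (s : Finset (Fin d)), P (∑ i ∈ s, m i)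
      (∏ i ∈ s, (X i ^ (m i % N) * g i ^ (m i / N))) (∏ i ∈ s, X i ^ m i) := by
    intro m s
    induction s using Finset.induction_on with
    | empty => simpa using hone
    | insert a s ha ih =>
      rw [Finset.sum_insert ha, Finset.prod_insert ha, Finset.prod_insert ha]
      refine hmul _ _ _ _ _ _ ?_ ih
      have := hmul _ _ _ _ _ _ (hX a (m a % N)) (hpow a (m a / N))
      rwa [← pow_add, Nat.mod_add_div] at this
  have key : ∀ m : Fin d →₀ ℕ, TT N g (monomial m 1) - monomial m 1 ∈ FF k d m.degree := by
    intro m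
    have := (hmon m univ).2.2
    rw [TT_monomial, aux_monomial_eq]
    rwa [Finsupp.degree_eq_sum]
  rw [FF, restrictSupport_eq_span] at hp
  induction hp using Submodule.span_induction with
  | mem x hx =>
    obtain ⟨m, hm, rfl⟩ := hx
    exact FF_mono (Nat.lt_succ_iff.1 hm) (key m)
  | zero => simp
  | add x y _ _ hx hy =>
    rw [map_add, add_sub_add_comm]; exact add_mem hx hy
  | smul a x _ hx =>
    rw [map_smul, ← smul_sub]; exact Submodule.smul_mem _ _ hx

theorem exists_FF (p : MvPolynomial (Fin d) k) : ∃ n, p ∈ FF k d n := by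
  refine ⟨p.support.sup (fun m => m.degree) + 1, mem_FF.2 fun m hm => ?_⟩
  exact Nat.lt_succ_iff.2 (Finset.le_sup (f := fun m : Fin d →₀ ℕ => m.degree) (mem_support_iff.2 hm))

theorem FF_zero {p : MvPolynomial (Fin d) k} (h : p ∈ FF k d 0) : p = 0 := by
  ext m
  by_contra hm
  exact absurd (mem_FF.1 h m (by simpa using hm)) (by simp)

theorem TT_surj (hN : 0 < N) (hg : ∀ i, g i - X i ^ N ∈ FF k d N) :
    Function.Surjective (TT N g) := by
  have : ∀ n, ∀ p ∈ FF k d n, ∃ q, TT N g q = p := by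
    intro n
    induction n with
    | zero => intro p hp; exact ⟨0, by simp [FF_zero hp]⟩
    | succ n ih =>
      intro p hp
      obtain ⟨q, hq⟩ := ih _ (TT_sub N g hN hg n p hp)
      exact ⟨p - q, by rw [map_sub, hq]; ring⟩
  intro p
  obtain ⟨n, hn⟩ := exists_FF p
  exact this n p hn

theorem TT_inj (hN : 0 < N) (hg : ∀ i, g i - X i ^ N ∈ FF k d N) :
    Function.Injective (TT N g) := by
  rw [injective_iff_map_eq_zero]
  intro p hp
  have : ∀ n, p ∈ FF k d n → p = 0 := by
    intro n
    induction n with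
    | zero => exact FF_zero
    | succ n ih =>
      intro hn
      have := TT_sub N g hN hg n p hn
      rw [hp, zero_sub, neg_mem_iff] at this
      exact ih this
  obtain ⟨n, hn⟩ := exists_FF p
  exact this n hn

theorem aux_prod_X_pow (α : Fin d → ℕ) : (∏ i, ((X i : MvPolynomial (Fin d) k) ^ N) ^ α i) =
    monomial (Finsupp.equivFunOnFinite.symm fun i => N * α i) 1 := by
  rw [aux_monomial_eq]
  simp [pow_mul]

theorem mem_JN {p : MvPolynomial (Fin d) k}
    (h : ∀ m : Fin d →₀ ℕ, (∀ i, m i < N) → p.coeff m = 0) :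
    p ∈ Ideal.span (Set.range fun i : Fin d => (X i : MvPolynomial (Fin d) k) ^ N) := by
  have hr : (Set.range fun i : Fin d => (X i : MvPolynomial (Fin d) k) ^ N) =
      (fun s => monomial s (1 : k)) '' (Set.range fun i : Fin d => Finsupp.single i N) := by
    rw [← Set.range_comp]
    congr 1
    ext1 i
    simp [X_pow_eq_monomial]
  rw [hr, mem_ideal_span_monomial_image]
  intro m hm
  by_contra! hcon
  refine mem_support_iff.1 hm (h m fun i => ?_)
  have := hcon _ ⟨i, rfl⟩
  by_contra! hi
  exact this (by simpa using hi)

theorem QReg_X (hN : 0 < N) : QReg fun i : Fin d => (X i : MvPolynomial (Fin d) k) ^ N := by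
  classical
  intro n c hc α hα
  apply mem_JN
  intro m hm
  obtain ⟨e, he⟩ := aux_mem_pow _ _ _ hc
  have := congrArg (coeff (m + Finsupp.equivFunOnFinite.symm fun i => N * α i)) he
  rw [coeff_sum, coeff_sum] at this
  have hle : ∀ β : Fin d → ℕ, (Finsupp.equivFunOnFinite.symm fun i => N * β i) ≤
      m + (Finsupp.equivFunOnFinite.symm fun i => N * α i) → β ≤ α := by
    intro β h i
    have h1 := h i
    simp at h1
    have h2 := hm i
    by_contra! h3
    have : N * (α i + 1) ≤ N * β i := Nat.mul_le_mul_left _ h3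
    rw [mul_add, mul_one] at this
    omega
  have hαs : ∑ i, α i = n := (mem_piAntidiag.1 hα).1
  rw [Finset.sum_eq_single α, Finset.sum_eq_zero] at this
  · rw [aux_prod_X_pow, coeff_mul_monomial, mul_one] at this
    exact this
  · intro β hβ
    rw [aux_prod_X_pow, coeff_mul_monomial', if_neg]
    intro h
    have h1 : ∑ i, β i ≤ ∑ i, α i := Finset.sum_le_sum fun i _ => hle β h i
    have h2 : ∑ i, β i = n + 1 := (mem_piAntidiag.1 hβ).1
    omega
  · intro β hβ hne
    rw [aux_prod_X_pow, coeff_mul_monomial', if_neg]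
    intro h
    have h2 : ∑ i, β i = n := (mem_piAntidiag.1 hβ).1
    apply hne
    funext i
    exact (Finset.sum_eq_sum_iff_of_le (fun i _ => hle β h i)).1 (h2.trans hαs.symm) i (mem_univ i)
  · exact fun h => absurd hα h

theorem QReg_g (hN : 0 < N) (hg : ∀ i, g i - X i ^ N ∈ FF k d N) : QReg g := by
  intro n c hc α hα
  obtain ⟨e, he⟩ := aux_mem_pow _ _ _ hc
  choose T' hT' using TT_surj N g hN hg
  set J0 := Ideal.span (Set.range fun i : Fin d => (X i : MvPolynomial (Fin d) k) ^ N) with hJ0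
  have key : ∀ n (c : (Fin d → ℕ) → MvPolynomial (Fin d) k),
      TT N g (∑ α ∈ piAntidiag univ n, T' (c α) * ∏ i, (X i ^ N) ^ α i) =
      ∑ α ∈ piAntidiag univ n, c α * ∏ i, g i ^ α i := by
    intro n c
    rw [map_sum]
    exact Finset.sum_congr rfl fun α _ => by rw [TT_shift' N g hN, hT']
  rw [← key, ← key] at he
  have he := TT_inj N g hN hg he
  have h1 := QReg_X (k := k) (d := d) N hN n (fun α => T' (c α)) (by
    rw [he]
    refine Ideal.sum_mem _ fun β hβ => Ideal.mul_mem_left _ _ ?_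
    have h2 : ∑ i, β i = n + 1 := (mem_piAntidiag.1 hβ).1
    rw [← h2, ← Finset.prod_pow_eq_pow_sum]
    exact Ideal.prod_mem_prod fun i _ => Ideal.pow_mem_pow (Ideal.subset_span (Set.mem_range_self i)) _) α hα
  obtain ⟨u, hu⟩ := Ideal.mem_span_range_iff_exists_fun.1 h1
  have h2 : c α = ∑ i, g i * TT N g (u i) := by
    rw [← hT' (c α), ← hu, map_sum]
    exact Finset.sum_congr rfl fun i _ => by rw [mul_comm, TT_shift N g hN]
  rw [h2]
  exact Ideal.sum_mem _ fun i _ => Ideal.mul_mem_right _ _ (Ideal.subset_span ⟨i, rfl⟩)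

end polyT

section transfer

variable {k : Type*} [Field k] {d : ℕ}

/-- the ideal of the `X i ^ M` in power series -/
noncomputable def XM (k : Type*) [Field k] (d M : ℕ) : Ideal (MvPowerSeries (Fin d) k) :=
  Ideal.span (Set.range fun i : Fin d => (MvPowerSeries.X i : MvPowerSeries (Fin d) k) ^ M)

theorem ps_mem (M : ℕ) (φ : MvPowerSeries (Fin d) k)
    (h : ∀ m : Fin d →₀ ℕ, (∀ i, m i < M) → MvPowerSeries.coeff m φ = 0) : φ ∈ XM k d M := by
  classical
  let ψ : Fin d → MvPowerSeries (Fin d) k := fun i m =>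
    if M ≤ m i ∧ ∀ j < i, m j < M then MvPowerSeries.coeff m φ else 0
  have hψ : ∀ i m, MvPowerSeries.coeff m (ψ i) =
    if M ≤ m i ∧ ∀ j < i, m j < M then MvPowerSeries.coeff m φ else 0 := fun i m => rfl
  have hsum : φ = ∑ i, ψ i := by
    ext m
    rw [map_sum]
    simp only [hψ]
    by_cases hm : ∀ i, m i < M
    · rw [h m hm]; simp
    · push Not at hm
      have hex : ∃ n : ℕ, ∃ hn : n < d, M ≤ m ⟨n, hn⟩ := by
        obtain ⟨i, hi⟩ := hm; exact ⟨i, i.2, hi⟩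
      obtain ⟨hn, hM⟩ := Nat.find_spec hex
      have hmin : ∀ j : Fin d, (j : ℕ) < Nat.find hex → m j < M := by
        intro j hj
        by_contra! hcon
        exact Nat.find_min hex hj ⟨j.2, hcon⟩
      rw [Finset.sum_eq_single ⟨Nat.find hex, hn⟩]
      · rw [if_pos]
        exact ⟨hM, fun j hj => hmin j hj⟩
      · intro j _ hj
        rw [if_neg]
        rintro ⟨h1, h2⟩
        rcases lt_trichotomy (j : ℕ) (Nat.find hex) with h3 | h3 | h3
        · exact absurd (hmin j h3) (by omega)
        · exact hj (Fin.ext h3)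
        · exact absurd (h2 ⟨Nat.find hex, hn⟩ h3) (by omega)
      · simp
  rw [hsum]
  refine Ideal.sum_mem _ fun i _ => ?_
  have : (MvPowerSeries.X i : MvPowerSeries (Fin d) k) ^ M ∣ ψ i := by
    rw [MvPowerSeries.X_pow_dvd_iff]
    intro m hm
    rw [hψ, if_neg]
    omega
  exact Ideal.mem_of_dvd _ this (Ideal.subset_span (Set.mem_range_self i))

theorem ps_coeff (M : ℕ) (φ : MvPowerSeries (Fin d) k) (hφ : φ ∈ XM k d M)
    (m : Fin d →₀ ℕ) (hm : ∀ i, m i < M) : MvPowerSeries.coeff m φ = 0 := by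
  obtain ⟨u, hu⟩ := Ideal.mem_span_range_iff_exists_fun.1 hφ
  rw [← hu, map_sum]
  refine Finset.sum_eq_zero fun i _ => ?_
  exact MvPowerSeries.X_pow_dvd_iff.1 (Dvd.intro_left (u i) rfl) m (hm i)

theorem ps_approx (M : ℕ) (φ : MvPowerSeries (Fin d) k) :
    ∃ p : MvPolynomial (Fin d) k, φ - coeToMvPowerSeries.ringHom p ∈ XM k d M := by
  classical
  refine ⟨MvPowerSeries.trunc' k (Finsupp.equivFunOnFinite.symm fun _ => M) φ, ?_⟩
  apply ps_mem
  intro m hm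
  rw [map_sub, coeToMvPowerSeries.ringHom_apply, MvPolynomial.coeff_coe, MvPowerSeries.coeff_trunc',
    if_pos, sub_self]
  intro i
  simpa using (hm i).le

theorem poly_mem (M : ℕ) (p : MvPolynomial (Fin d) k)
    (hp : coeToMvPowerSeries.ringHom p ∈ XM k d M) :
    p ∈ Ideal.span (Set.range fun i : Fin d => (X i : MvPolynomial (Fin d) k) ^ M) := by
  apply mem_JN
  intro m hm
  have := ps_coeff M _ hp m hm
  rwa [coeToMvPowerSeries.ringHom_apply, MvPolynomial.coeff_coe] at this

theorem QReg.toPS (g : Fin d → MvPolynomial (Fin d) k) (hq : QReg g) (s : ℕ)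
    (hs : XM k d s ≤ Ideal.span (Set.range fun i => coeToMvPowerSeries.ringHom (g i))) :
    QReg fun i => (coeToMvPowerSeries.ringHom (g i) : MvPowerSeries (Fin d) k) := by
  intro n c hc α hα
  set ι : MvPolynomial (Fin d) k →+* MvPowerSeries (Fin d) k := coeToMvPowerSeries.ringHom with hι
  set I := Ideal.span (Set.range fun i => ι (g i)) with hI
  set J := Ideal.span (Set.range g) with hJ
  have hgI : ∀ i, ι (g i) ∈ I := fun i => Ideal.subset_span (Set.mem_range_self i)
  have hgJ : ∀ i, g i ∈ J := fun i => Ideal.subset_span (Set.mem_range_self i)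
  have hJI : ∀ x ∈ J, ι x ∈ I := by
    intro x hx
    have : J ≤ I.comap ι := by
      rw [hJ, Ideal.span_le]
      rintro _ ⟨i, rfl⟩
      exact hgI i
    exact this hx
  have happ := fun α => ps_approx s (c α)
  choose c' hc' using happ
  let z : MvPolynomial (Fin d) k := ∑ α ∈ piAntidiag univ n, c' α * ∏ i, g i ^ α i
  have hz : ι z ∈ I ^ (n + 1) := by
    have : ι z = ∑ α ∈ piAntidiag univ n, c α * ∏ i, ι (g i) ^ α i -
        ∑ α ∈ piAntidiag univ n, (c α - ι (c' α)) * ∏ i, ι (g i) ^ α i := by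
      rw [← Finset.sum_sub_distrib]
      simp only [z, map_sum, map_mul, map_prod, map_pow]
      exact Finset.sum_congr rfl fun _ _ => by ring
    rw [this]
    refine sub_mem hc (Ideal.sum_mem _ fun β hβ => ?_)
    rw [pow_succ']
    refine Ideal.mul_mem_mul (hs (hc' β)) ?_
    have h2 : ∑ i, β i = n := (mem_piAntidiag.1 hβ).1
    rw [← h2]
    exact aux_mon_mem I _ hgI β
  obtain ⟨h, hh⟩ := aux_mem_pow _ _ _ hz
  let m : Ideal (MvPolynomial (Fin d) k) := Ideal.span (Set.range X)
  have hzM : ∀ M : ℕ, ∃ y ∈ m ^ M, z - y ∈ J ^ (n + 1) := by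
    intro M
    choose h' hh' using fun α => ps_approx M (h α)
    refine ⟨z - ∑ α ∈ piAntidiag univ (n+1), h' α * ∏ i, g i ^ α i, ?_, ?_⟩
    · have h1 : ι (z - ∑ α ∈ piAntidiag univ (n+1), h' α * ∏ i, g i ^ α i) ∈ XM k d M := by
        rw [map_sub, hh]
        simp only [map_sum, map_mul, map_prod, map_pow]
        rw [← Finset.sum_sub_distrib]
        refine Ideal.sum_mem _ fun β _ => ?_
        rw [← sub_mul]
        exact Ideal.mul_mem_right _ _ (hh' β)
      have h2 := poly_mem M _ h1
      refine Ideal.span_le.2 ?_ h2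
      rintro _ ⟨i, rfl⟩
      exact Ideal.pow_mem_pow (Ideal.subset_span (Set.mem_range_self i)) _
    · rw [sub_sub_cancel]
      refine Ideal.sum_mem _ fun β hβ => Ideal.mul_mem_left _ _ ?_
      have h2 : ∑ i, β i = n + 1 := (mem_piAntidiag.1 hβ).1
      rw [← h2]
      exact aux_mon_mem J _ hgJ β
  have hinf : (Submodule.Quotient.mk z : MvPolynomial (Fin d) k ⧸ J ^ (n + 1)) ∈
      (⨅ i : ℕ, m ^ i • ⊤ : Submodule (MvPolynomial (Fin d) k)
        (MvPolynomial (Fin d) k ⧸ J ^ (n + 1))) := by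
    rw [Submodule.mem_iInf]
    intro M
    obtain ⟨y, hy, hzy⟩ := hzM M
    have h1 : (Submodule.Quotient.mk z : MvPolynomial (Fin d) k ⧸ J ^ (n + 1)) =
        y • (Submodule.Quotient.mk 1 : MvPolynomial (Fin d) k ⧸ J ^ (n + 1)) := by
      rw [← Submodule.Quotient.mk_smul, smul_eq_mul, mul_one]
      exact (Submodule.Quotient.eq _).2 hzy
    rw [h1]
    exact Submodule.smul_mem_smul hy trivial
  obtain ⟨r, hr⟩ := (Ideal.mem_iInf_smul_pow_eq_bot_iff m _).1 hinf
  have hr' : (1 - (r : MvPolynomial (Fin d) k)) * z ∈ J ^ (n + 1) := by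
    have h1 : (Submodule.Quotient.mk z : MvPolynomial (Fin d) k ⧸ J ^ (n + 1)) =
      Submodule.Quotient.mk ((r : MvPolynomial (Fin d) k) * z) := hr.symm
    rw [sub_mul, one_mul]
    exact (Submodule.Quotient.eq _).1 h1
  have hfin := hq n (fun α => (1 - (r : MvPolynomial (Fin d) k)) * c' α) (by
    have : ∑ α ∈ piAntidiag univ n, (1 - (r : MvPolynomial (Fin d) k)) * c' α * ∏ i, g i ^ α i =
        (1 - (r : MvPolynomial (Fin d) k)) * z := by
      simp only [z, Finset.mul_sum, mul_assoc]
    rw [this]; exact hr') α hα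
  have h1 := hJI _ hfin
  rw [map_mul] at h1
  have hu : IsUnit (ι (1 - (r : MvPolynomial (Fin d) k))) := by
    rw [MvPowerSeries.isUnit_iff_constantCoeff]
    have hm : ∀ x ∈ m, MvPowerSeries.constantCoeff (ι x) = 0 := by
      intro x hx
      have : m ≤ RingHom.ker ((MvPowerSeries.constantCoeff (σ := Fin d) (R := k)).comp ι) := by
        rw [Ideal.span_le]
        rintro _ ⟨i, rfl⟩
        simp [RingHom.mem_ker, hι]
      exact this hx
    rw [map_sub, map_sub, hm _ r.2]
    simp
  have h2 : ι (c' α) ∈ I := (Ideal.unit_mul_mem_iff_mem _ hu).1 h1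
  have := add_mem (hs (hc' α)) h2
  rwa [sub_add_cancel] at this

end transfer

section count

/-- lattice points in a weighted simplex -/
def SS {d : ℕ} (w : Fin d → ℕ) (M : ℕ) : Finset (Fin d → ℕ) :=
  (Fintype.piFinset fun _ => range (M + 1)).filter fun α => ∑ i, α i * w i ≤ M

theorem mem_SS {d : ℕ} {w : Fin d → ℕ} (hw : ∀ i, 0 < w i) {M : ℕ} {α : Fin d → ℕ} :
    α ∈ SS w M ↔ ∑ i, α i * w i ≤ M := by
  rw [SS, mem_filter, and_iff_right_iff_imp]
  intro h
  rw [Fintype.mem_piFinset]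
  intro i
  rw [mem_range, Nat.lt_succ_iff]
  calc α i ≤ α i * w i := Nat.le_mul_of_pos_right _ (hw i)
    _ ≤ ∑ i, α i * w i := Finset.single_le_sum (f := fun i => α i * w i) (fun _ _ => Nat.zero_le _) (mem_univ i)
    _ ≤ M := h

theorem SS_upper {d : ℕ} {w : Fin d → ℕ} (hw : ∀ i, 0 < w i) (M : ℕ) :
    #(SS w M) * ∏ i, w i ≤ #(SS (fun _ : Fin d => 1) (M + ∑ i, w i)) := by
  have : #(SS w M) * ∏ i, w i = #((SS w M) ×ˢ Fintype.piFinset fun i => range (w i)) := by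
    rw [card_product, Fintype.card_piFinset]; simp
  rw [this]
  refine Finset.card_le_card_of_injOn (fun p i => p.1 i * w i + p.2 i) ?_ ?_
  · rintro ⟨α, r⟩ h
    simp only [coe_product, Set.mem_prod, mem_coe, mem_SS hw, Fintype.mem_piFinset, mem_range] at h
    simp only [mem_coe]
    rw [mem_SS (by simp)]
    simp only [mul_one, Finset.sum_add_distrib]
    exact add_le_add h.1 (Finset.sum_le_sum fun i _ => (h.2 i).le)
  · rintro ⟨α, r⟩ h ⟨α', r'⟩ h' heq
    simp only [coe_product, Set.mem_prod, mem_coe, mem_SS hw, Fintype.mem_piFinset, mem_range] at h h'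
    have h1 : ∀ i, α i * w i + r i = α' i * w i + r' i := fun i => congrFun heq i
    have h2 : r = r' := by
      funext i
      have := congrArg (· % w i) (h1 i)
      simpa [Nat.add_mod, Nat.mod_eq_of_lt (h.2 i), Nat.mod_eq_of_lt (h'.2 i)] using this
    subst h2
    have h3 : α = α' := by
      funext i
      have := h1 i
      exact Nat.eq_of_mul_eq_mul_right (hw i) (by omega)
    rw [h3]

theorem SS_lower {d : ℕ} {w : Fin d → ℕ} (hw : ∀ i, 0 < w i) (M : ℕ) :
    #(SS (fun _ : Fin d => 1) M) ≤ #(SS w M) * ∏ i, w i := by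
  have : #(SS w M) * ∏ i, w i = #((SS w M) ×ˢ Fintype.piFinset fun i => range (w i)) := by
    rw [card_product, Fintype.card_piFinset]; simp
  rw [this]
  refine Finset.card_le_card_of_injOn (fun γ => (fun i => γ i / w i, fun i => γ i % w i)) ?_ ?_
  · intro γ h
    rw [mem_coe, mem_SS (by simp)] at h
    simp only [coe_product, Set.mem_prod, mem_coe, mem_SS hw, Fintype.mem_piFinset, mem_range]
    refine ⟨le_trans (Finset.sum_le_sum fun i _ => ?_) h, fun i => Nat.mod_lt _ (hw i)⟩
    rw [mul_one]
    exact Nat.div_mul_le_self _ _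
  · intro γ _ γ' _ h
    rw [Prod.mk.injEq] at h
    funext i
    rw [← Nat.mod_add_div (γ i) (w i), ← Nat.mod_add_div (γ' i) (w i)]
    have h1 : γ i / w i = γ' i / w i := congrFun h.1 i
    have h2 : γ i % w i = γ' i % w i := congrFun h.2 i
    rw [h1, h2]

theorem SS_poly {d : ℕ} (M : ℕ) : #(SS (fun _ : Fin d => 1) M) ≤ (M + 1) ^ d := by
  refine (Finset.card_filter_le _ _).trans ?_
  rw [Fintype.card_piFinset]
  simp

theorem count_main {d : ℕ} {w e : Fin d → ℕ} (hw : ∀ i, 0 < w i) (he : ∀ i, 0 < e i) (D C : ℕ)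
    (h : ∀ M, D * #(SS e M) ≤ #(SS w (M + C))) : D * ∏ i, w i ≤ ∏ i, e i := by
  by_contra! hcon
  set W := ∏ i, w i
  set E := ∏ i, e i with hE
  have hEpos : 0 < E := Finset.prod_pos fun i _ => he i
  let L : ℕ → ℕ := fun M => #(SS (fun _ : Fin d => 1) M)
  let c := C + ∑ i, w i
  have h1 : ∀ M, (E + 1) * L M ≤ E * L (M + c) := by
    intro M
    calc (E + 1) * L M ≤ (D * W) * L M := Nat.mul_le_mul_right _ hcon
      _ ≤ (D * W) * (#(SS e M) * E) := Nat.mul_le_mul_left _ (SS_lower he M)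
      _ = (D * #(SS e M)) * (W * E) := by ring
      _ ≤ #(SS w (M + C)) * (W * E) := Nat.mul_le_mul_right _ (h M)
      _ = E * (#(SS w (M + C)) * W) := by ring
      _ ≤ E * L (M + C + ∑ i, w i) := Nat.mul_le_mul_left _ (SS_upper hw _)
      _ = E * L (M + c) := by rw [add_assoc]
  have h0 : 1 ≤ L 0 := Finset.card_pos.2 ⟨0, (mem_SS (by simp)).2 (by simp)⟩
  have h2 : ∀ j, (E + 1) ^ j ≤ E ^ j * L (j * c) := by
    intro j
    induction j with
    | zero => simpa using h0
    | succ j ih =>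
      calc (E + 1) ^ (j + 1) = (E + 1) ^ j * (E + 1) := pow_succ _ _
        _ ≤ E ^ j * L (j * c) * (E + 1) := Nat.mul_le_mul_right _ ih
        _ = E ^ j * ((E + 1) * L (j * c)) := by ring
        _ ≤ E ^ j * (E * L (j * c + c)) := Nat.mul_le_mul_left _ (h1 _)
        _ = E ^ (j + 1) * L ((j + 1) * c) := by rw [pow_succ, add_mul, one_mul, mul_assoc]
  have h3 : ∀ j, 1 ≤ j → (E + 1) ^ j ≤ E ^ j * ((c + 1) ^ d * j ^ d) := by
    intro j hj
    refine (h2 j).trans (Nat.mul_le_mul_left _ ((SS_poly _).trans ?_))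
    rw [← mul_pow]
    refine Nat.pow_le_pow_left ?_ _
    nlinarith
  have hE0 : (0 : ℝ) < E := by exact_mod_cast hEpos
  have hr : (1 : ℝ) < ((E : ℝ) + 1) / E := by
    rw [lt_div_iff₀ hE0]; linarith
  have hlim := tendsto_pow_const_div_const_pow_of_one_lt d hr
  have hpos : (0 : ℝ) < 1 / ((c : ℝ) + 1) ^ d := by positivity
  obtain ⟨j, hj1, hj2⟩ := ((hlim.eventually (gt_mem_nhds hpos)).and
    (Filter.eventually_ge_atTop 1)).exists
  have h4 : ((E : ℝ) + 1) ^ j ≤ (E : ℝ) ^ j * (((c : ℝ) + 1) ^ d * (j : ℝ) ^ d) := by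
    exact_mod_cast h3 j hj2
  rw [div_pow, div_div_eq_mul_div, div_lt_div_iff₀ (by positivity) (by positivity)] at hj1
  nlinarith

end count

section final

variable {k : Type*} [Field k] {d : ℕ}

/-- polynomials of weighted degree at most `n` -/
noncomputable def WW (k : Type*) [Field k] {d : ℕ} (w : Fin d → ℕ) (n : ℕ) :
    Submodule k (MvPolynomial (Fin d) k) :=
  MvPolynomial.restrictSupport k {m | ∑ i, m i * w i ≤ n}

theorem mem_WW {w : Fin d → ℕ} {n : ℕ} {p : MvPolynomial (Fin d) k} :
    p ∈ WW k w n ↔ ∀ m, p.coeff m ≠ 0 → ∑ i, m i * w i ≤ n := by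
  rw [WW, mem_restrictSupport_iff]
  constructor
  · intro h m hm; exact h (mem_support_iff.2 hm)
  · intro h m hm; exact h m (mem_support_iff.1 hm)

theorem WW_mul {w : Fin d → ℕ} {a b : ℕ} {p q : MvPolynomial (Fin d) k}
    (hp : p ∈ WW k w a) (hq : q ∈ WW k w b) : p * q ∈ WW k w (a + b) := by
  classical
  rw [mem_WW] at *
  intro m hm
  rw [coeff_mul] at hm
  obtain ⟨⟨x, y⟩, hxy, h⟩ := Finset.exists_ne_zero_of_sum_ne_zero hm
  have h1 := hp x (left_ne_zero_of_mul h)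
  have h2 := hq y (right_ne_zero_of_mul h)
  rw [HasAntidiagonal.mem_antidiagonal] at hxy
  simp only at hxy
  rw [← hxy]
  simp only [Finsupp.add_apply, add_mul, Finset.sum_add_distrib]
  omega

theorem WW_mono {w : Fin d → ℕ} {a b : ℕ} (h : a ≤ b) : WW k w a ≤ WW k w b := by
  intro p hp
  rw [mem_WW] at *
  exact fun m hm => (hp m hm).trans h

theorem WW_one {w : Fin d → ℕ} : (1 : MvPolynomial (Fin d) k) ∈ WW k w 0 := by
  rw [WW, one_def, monomial_mem_restrictSupport]; left; simp

theorem WW_self (w : Fin d → ℕ) (p : MvPolynomial (Fin d) k) :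
    p ∈ WW k w (weightedTotalDegree w p) := by
  rw [mem_WW]
  intro m hm
  have := le_weightedTotalDegree w (mem_support_iff.2 hm)
  rw [Finsupp.weight_apply, Finsupp.sum_fintype _ _ (by simp)] at this
  simpa using this

theorem WW_pow {w : Fin d → ℕ} {a : ℕ} {p : MvPolynomial (Fin d) k} (hp : p ∈ WW k w a) (n : ℕ) :
    p ^ n ∈ WW k w (n * a) := by
  induction n with
  | zero => simpa using WW_one
  | succ n ih => rw [pow_succ, add_mul, one_mul]; exact WW_mul ih hp

theorem WW_prod {w : Fin d → ℕ} (f : Fin d → MvPolynomial (Fin d) k) (α : Fin d → ℕ) :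
    ∏ i, f i ^ α i ∈ WW k w (∑ i, α i * weightedTotalDegree w (f i)) := by
  have : ∀ s : Finset (Fin d),
      ∏ i ∈ s, f i ^ α i ∈ WW k w (∑ i ∈ s, α i * weightedTotalDegree w (f i)) := by
    intro s
    induction s using Finset.induction_on with
    | empty => simpa using WW_one
    | insert a s ha ih =>
      rw [Finset.sum_insert ha, Finset.prod_insert ha]
      exact WW_mul (WW_pow (WW_self w _) _) ih
  exact this univ

theorem WW_dim {w : Fin d → ℕ} (hw : ∀ i, 0 < w i) (n : ℕ) :
    Module.Finite k (WW k w n) ∧ Module.finrank k (WW k w n) = #(SS w n) := by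
  let e : {m : Fin d →₀ ℕ | ∑ i, m i * w i ≤ n} ≃ SS w n :=
    Finsupp.equivFunOnFinite.subtypeEquiv fun m => by
      rw [mem_SS hw]; rfl
  have B : Module.Basis (SS w n) k (WW k w n) := (basisRestrictSupport k _).reindex e
  exact ⟨Module.Finite.of_basis B, by rw [Module.finrank_eq_card_basis B]; simp⟩

theorem X_pow_mem (I : Ideal (MvPowerSeries (Fin d) k))
    [FiniteDimensional k (MvPowerSeries (Fin d) k ⧸ I)] (i : Fin d) :
    ∃ s, (MvPowerSeries.X i : MvPowerSeries (Fin d) k) ^ s ∈ I := by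
  have : IsArtinianRing (MvPowerSeries (Fin d) k ⧸ I) := IsArtinianRing.of_finite k _
  obtain ⟨n, y, hy⟩ := IsArtinian.exists_pow_succ_smul_dvd
    (Ideal.Quotient.mk I (MvPowerSeries.X i)) (1 : MvPowerSeries (Fin d) k ⧸ I)
  obtain ⟨y, rfl⟩ := Ideal.Quotient.mk_surjective y
  refine ⟨n, ?_⟩
  have hu : IsUnit (1 - MvPowerSeries.X i * y : MvPowerSeries (Fin d) k) := by
    rw [MvPowerSeries.isUnit_iff_constantCoeff]; simp
  refine (Ideal.unit_mul_mem_iff_mem _ hu).1 ?_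
  rw [← Ideal.Quotient.eq_zero_iff_mem]
  simp only [smul_eq_mul, mul_one, Nat.succ_eq_add_one, pow_succ] at hy
  simp only [map_mul, map_sub, map_pow, map_one, sub_mul, one_mul]
  linear_combination -hy

theorem QReg_f (f : Fin d → MvPolynomial (Fin d) k)
    (I : Ideal (MvPowerSeries (Fin d) k))
    (hI : I = Ideal.span (Set.range fun i => coeToMvPowerSeries.ringHom (f i)))
    [FiniteDimensional k (MvPowerSeries (Fin d) k ⧸ I)] (htop : I ≠ ⊤) :
    (∃ s, XM k d s ≤ I) ∧
    QReg fun i => (coeToMvPowerSeries.ringHom (f i) : MvPowerSeries (Fin d) k) := by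
  set ι : MvPolynomial (Fin d) k →+* MvPowerSeries (Fin d) k := coeToMvPowerSeries.ringHom with hι
  choose s hs using X_pow_mem I
  choose t ht using fun i => exists_FF (f i)
  let S := ∑ i, s i
  let N := 2 * S + ∑ i, t i + 1
  have hsS : ∀ i, s i ≤ S := fun i => Finset.single_le_sum (fun _ _ => Nat.zero_le _) (mem_univ i)
  have htT : ∀ i, t i ≤ ∑ i, t i := fun i =>
    Finset.single_le_sum (fun _ _ => Nat.zero_le _) (mem_univ i)
  have hS : XM k d S ≤ I := by
    rw [XM, Ideal.span_le]
    rintro _ ⟨i, rfl⟩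
    exact Ideal.mem_of_dvd _ (pow_dvd_pow _ (hsS i)) (hs i)
  refine ⟨⟨S, hS⟩, ?_⟩
  have hXN : ∀ i, (MvPowerSeries.X i : MvPowerSeries (Fin d) k) ^ N ∈ I ^ 2 := by
    intro i
    refine Ideal.mem_of_dvd _ (pow_dvd_pow _ (show S * 2 ≤ N by omega)) ?_
    rw [pow_mul]
    exact Ideal.pow_mem_pow (hS (Ideal.subset_span (Set.mem_range_self i))) 2
  let g : Fin d → MvPolynomial (Fin d) k := fun i => f i + X i ^ N
  have hιg : ∀ i, ι (g i) = ι (f i) + MvPowerSeries.X i ^ N := by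
    intro i; simp [g, hι]
  have hfI : ∀ i, ι (f i) ∈ I := fun i => hI ▸ Ideal.subset_span (Set.mem_range_self i)
  have hgQ : QReg g := QReg_g N g (by omega) fun i => by
    have : g i - X i ^ N = f i := by simp [g]
    rw [this]
    have := htT i
    exact FF_mono (by omega) (ht i)
  have hIg : I = Ideal.span (Set.range fun i => ι (g i)) := by
    apply le_antisymm
    · refine Submodule.le_of_le_smul_of_le_jacobson_bot (I := I) ?_ ?_ ?_
      · rw [hI]; exact ⟨(Set.finite_range _).toFinset, by simp; rfl⟩
      · rw [IsLocalRing.jacobson_eq_maximalIdeal ⊥ bot_ne_top]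
        exact IsLocalRing.le_maximalIdeal htop
      · conv_lhs => rw [hI]
        rw [Ideal.span_le]
        rintro _ ⟨i, rfl⟩
        have h1 : ι (f i) = ι (g i) + - MvPowerSeries.X i ^ N := by rw [hιg]; ring
        show ι (f i) ∈ _
        rw [h1]
        refine Submodule.add_mem_sup (Ideal.subset_span (Set.mem_range_self i)) ?_
        rw [smul_eq_mul, ← sq]
        exact neg_mem (hXN i)
    · rw [Ideal.span_le]
      rintro _ ⟨i, rfl⟩
      show ι (g i) ∈ I
      rw [hιg]
      exact add_mem (hfI i) (Ideal.pow_le_self two_ne_zero (hXN i))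
  have hgA := QReg.toPS g hgQ S (hIg ▸ hS)
  refine QReg.transfer _ _ hgA (hI.symm.trans hIg) fun i => ?_
  rw [← hI]
  show ι (f i) - ι (g i) ∈ I ^ 2
  rw [hιg, sub_add_cancel_left]
  exact neg_mem (hXN i)

/-- coercion as a linear map -/
noncomputable def coeLin (k : Type*) [Field k] (d : ℕ) :
    MvPolynomial (Fin d) k →ₗ[k] MvPowerSeries (Fin d) k where
  toFun p := coeToMvPowerSeries.ringHom p
  map_add' p q := map_add _ p q
  map_smul' a p := by simp

end final

theorem stmt1 (k : Type*) [Field k] (d : ℕ) (hd : 0 < d) (w : Fin d → ℕ)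
    (hw : ∀ i, 0 < w i) (hgcd : Finset.univ.gcd w = 1)
    (f : Fin d → MvPolynomial (Fin d) k) (hf : ∀ i, f i ≠ 0)
    (hfin : FiniteDimensional k
      (MvPowerSeries (Fin d) k ⧸
        Ideal.span (Set.range fun i => ((f i : MvPowerSeries (Fin d) k))))) :
    Module.finrank k
        (MvPowerSeries (Fin d) k ⧸
          Ideal.span (Set.range fun i => ((f i : MvPowerSeries (Fin d) k)))) *
        ∏ i, w i ≤
      ∏ i, MvPolynomial.weightedTotalDegree w (f i) := by
  classical
  set I := Ideal.span (Set.range fun i => ((f i : MvPowerSeries (Fin d) k))) with hI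
  set D := Module.finrank k (MvPowerSeries (Fin d) k ⧸ I) with hD
  by_cases htop : I = ⊤
  · have : Subsingleton (MvPowerSeries (Fin d) k ⧸ I) := Ideal.Quotient.subsingleton_iff.2 htop
    have : D = 0 := Module.finrank_zero_of_subsingleton
    simp [this]
  have he : ∀ i, 0 < weightedTotalDegree w (f i) := by
    intro i
    by_contra! h0
    apply htop
    have h1 := WW_self w (f i)
    rw [mem_WW] at h1
    have h2 : ∀ m, (f i).coeff m ≠ 0 → m = 0 := by
      intro m hm
      have h3 := h1 m hm
      have h4 : ∑ i, m i * w i = 0 := by omega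
      ext j
      have h5 := Finset.sum_eq_zero_iff.1 h4 j (mem_univ j)
      have := hw j
      simpa [this.ne'] using h5
    have h3 : (f i).coeff 0 ≠ 0 := by
      obtain ⟨m, hm⟩ := MvPolynomial.ne_zero_iff.1 (hf i)
      rwa [h2 m hm] at hm
    refine Ideal.eq_top_of_isUnit_mem I (x := ((f i : MvPowerSeries (Fin d) k)))
      (Ideal.subset_span (Set.mem_range_self i)) ?_
    rw [MvPowerSeries.isUnit_iff_constantCoeff, isUnit_iff_ne_zero,
      ← MvPowerSeries.coeff_zero_eq_constantCoeff_apply, MvPolynomial.coeff_coe]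
    exact h3
  obtain ⟨⟨s, hs⟩, hq⟩ := QReg_f f I hI htop
  let B := Module.finBasis k (MvPowerSeries (Fin d) k ⧸ I)
  have hb : ∀ j, ∃ p : MvPolynomial (Fin d) k,
      Ideal.Quotient.mk I (coeToMvPowerSeries.ringHom p) = B j := by
    intro j
    obtain ⟨φ, hφ⟩ := Ideal.Quotient.mk_surjective (B j)
    obtain ⟨p, hp⟩ := ps_approx s φ
    exact ⟨p, by rw [← hφ, eq_comm]; exact Ideal.Quotient.eq.2 (hs hp)⟩
  choose b hb using hb
  have hlin := QReg.linInd (k := k) (D := D) _ hq (fun j => coeToMvPowerSeries.ringHom (b j)) (by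
    have : (fun j => Ideal.Quotient.mk I (coeToMvPowerSeries.ringHom (b j))) = B := funext hb
    show LinearIndependent k (fun j => Ideal.Quotient.mk I (coeToMvPowerSeries.ringHom (b j)))
    rw [this]
    exact B.linearIndependent)
  have hlin2 : LinearIndependent k
      fun p : (Fin d → ℕ) × Fin D => b p.2 * ∏ i, f i ^ p.1 i := by
    refine LinearIndependent.of_comp (coeLin k d) ?_
    have heq : (coeLin k d ∘ fun p : (Fin d → ℕ) × Fin D => b p.2 * ∏ i, f i ^ p.1 i) =
        fun p => coeToMvPowerSeries.ringHom (b p.2) *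
          ∏ i, coeToMvPowerSeries.ringHom (f i) ^ p.1 i := by
      funext p
      change coeToMvPowerSeries.ringHom (b p.2 * ∏ i, f i ^ p.1 i) = _
      rw [map_mul, map_prod]
      simp only [map_pow]
    rw [heq]
    exact hlin
  refine count_main hw he D (∑ j, weightedTotalDegree w (b j)) fun M => ?_
  set C := ∑ j, weightedTotalDegree w (b j)
  obtain ⟨hWf, hWd⟩ := WW_dim (k := k) hw (M + C)
  let T : Finset ((Fin d → ℕ) × Fin D) :=
    SS (fun i => weightedTotalDegree w (f i)) M ×ˢ univ
  have hmem : ∀ p : T, b p.1.2 * ∏ i, f i ^ p.1.1 i ∈ WW k w (M + C) := by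
    rintro ⟨⟨α, j⟩, hp⟩
    have hα : α ∈ SS (fun i => weightedTotalDegree w (f i)) M := (mem_product.1 hp).1
    rw [mem_SS he] at hα
    have hj : weightedTotalDegree w (b j) ≤ C :=
      Finset.single_le_sum (f := fun j => weightedTotalDegree w (b j))
        (fun _ _ => Nat.zero_le _) (mem_univ j)
    exact WW_mono (by omega) (WW_mul (WW_self w (b j)) (WW_prod f α))
  have hlin3 : LinearIndependent k
      fun p : T => (⟨b p.1.2 * ∏ i, f i ^ p.1.1 i, hmem p⟩ : WW k w (M + C)) := by
    refine LinearIndependent.of_comp (WW k w (M + C)).subtype ?_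
    exact hlin2.comp (fun p : T => p.1) Subtype.val_injective
  have := hlin3.fintype_card_le_finrank
  rw [hWd, Fintype.card_coe, card_product] at this
  simpa [mul_comm] using this
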